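/- arXiv:2102.12273 — 9 statements merged into one kernel-verified Lean document; each statement's English description precedes it below -/
import Mathlib

section
/- FastPay transfer certificate uniqueness (Lemma: Transfer certificate uniqueness): Suppose the set of authorities S has |S| = 3f+1 and the Byzantine authorities form D ⊆ S with |D| ≤ f. Assume every honest authority signs at most one transfer order per (sender, sequence number) pair: for α ∈ S \ D, if signs α O and signs α O' with sender(O) = sender(O') and sequence(O) = sequence(O'), then O = O'. If two transfer orders O and O' are each certified — i.e., for each there is a quorum Q ⊆ S with |Q| ≥ 2f+1 all of whose members sign it — and sender(O) = sender(O') and sequence(O) = sequence(O'), then O = O'. -/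
/-- FastPay transfer certificate uniqueness: if every honest authority signs at
most one transfer order per (sender, sequence number) pair, then two certified
transfer orders with the same sender and sequence number are equal. -/
theorem transfer_certificate_uniqueness
    {Authority Order Account : Type*} [DecidableEq Authority]
    (f : ℕ) (S D : Finset Authority)
    (hS : S.card = 3 * f + 1) (hDS : D ⊆ S) (hD : D.card ≤ f)
    (sender : Order → Account) (sequence : Order → ℕ)
    (signs : Authority → Order → Prop)
    (honest_signs_once : ∀ α ∈ S \ D, ∀ O O' : Order,
      signs α O → signs α O' →
      sender O = sender O' → sequence O = sequence O' → O = O')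
    (O O' : Order)
    (hcert : ∃ Q : Finset Authority, Q ⊆ S ∧ 2 * f + 1 ≤ Q.card ∧ ∀ α ∈ Q, signs α O)
    (hcert' : ∃ Q : Finset Authority, Q ⊆ S ∧ 2 * f + 1 ≤ Q.card ∧ ∀ α ∈ Q, signs α O')
    (hsender : sender O = sender O') (hseq : sequence O = sequence O') :
    O = O' := by
  obtain ⟨Q, hQ, hc, hs⟩ := hcert
  obtain ⟨Q', hQ', hc', hs'⟩ := hcert'
  have h1 := Finset.card_union_add_card_inter Q Q'
  have h2 := Finset.card_le_card (Finset.union_subset hQ hQ')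
  have h3 : D.card < (Q ∩ Q').card := by omega
  obtain ⟨a, ha, hna⟩ := Finset.exists_mem_notMem_of_card_lt_card h3
  rw [Finset.mem_inter] at ha
  exact honest_signs_once a (Finset.mem_sdiff.2 ⟨hQ ha.1, hna⟩) O O'
    (hs a ha.1) (hs' a ha.2) hsender hseq
end

section
/- Solvency of FastPay (Theorem: Solvency of FastPay, derived from account safety): Let C be a finite set of transfer certificates, each certificate c having a sender account sender(c), a non-negative amount amount(c) : ℕ, and a recipient fp(c) : Option Acc, where fp(c) = some a means the recipient is the FastPay account a and fp(c) = none means the recipient is a Primary address. Let A be a finite set of accounts containing sender(c) for every c ∈ C, and funding : Acc → ℕ. Assume account safety for every a ∈ A: ∑_{c ∈ C, sender(c) = a} amount(c) ≤ funding(a) + ∑_{c ∈ C, fp(c) = some a} amount(c). Then the sum of the amounts of all certified transfers to the Primary cannot exceed the total funding: ∑_{c ∈ C, fp(c) = none} amount(c) ≤ ∑_{a ∈ A} funding(a). -/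
/-- Solvency of FastPay: assuming account safety for each account, the total
amount of certified transfers to the Primary cannot exceed the total funding. -/
theorem fastpay_solvency {Acc Cert : Type*} [DecidableEq Acc] [DecidableEq Cert]
    (sender : Cert → Acc) (amount : Cert → ℕ) (fp : Cert → Option Acc)
    (C : Finset Cert) (A : Finset Acc) (funding : Acc → ℕ)
    (hsender : ∀ c ∈ C, sender c ∈ A)
    (hsafety : ∀ a ∈ A,
      ∑ c ∈ C.filter (fun c => sender c = a), amount c ≤
        funding a + ∑ c ∈ C.filter (fun c => fp c = some a), amount c) :
    ∑ c ∈ C.filter (fun c => fp c = none), amount c ≤ ∑ a ∈ A, funding a := by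
  have h1 := Finset.sum_le_sum hsafety
  rw [Finset.sum_fiberwise_of_maps_to hsender, Finset.sum_add_distrib] at h1
  have h2 : ∑ c ∈ C.filter (fun c => fp c = none), amount c +
      ∑ a ∈ A, ∑ c ∈ C.filter (fun c => fp c = some a), amount c ≤ ∑ c ∈ C, amount c := by
    simp only [Finset.sum_filter]
    rw [Finset.sum_comm, ← Finset.sum_add_distrib]
    refine Finset.sum_le_sum fun c _ => ?_
    cases h : fp c with
    | none => simp
    | some b =>
      simp only [Option.some.injEq, Finset.sum_ite_eq]
      split_ifs <;> simp_all
  omega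
end

section
/- Byzcuit Consistency (Theorem: Consistency, abstract core): Fix f : ℕ. Suppose each object o is managed by a shard shard(o), a finset of nodes of cardinality 3f+1, and let Byz be the set of Byzantine nodes with |shard(o) ∩ Byz| ≤ f for every object o (Honest Shard assumption). Assume every honest node pre-accepts at most one transaction per object: for n ∉ Byz, preAccept n o T and preAccept n o T' imply T = T'. Call a transaction T committed if for every o ∈ inputs(T) there exists a quorum Q ⊆ shard(o) with |Q| ≥ 2f+1 such that every n ∈ Q satisfies preAccept n o T. Then no two conflicting transactions are committed: if T and T' are both committed and share an input object (inputs(T) ∩ inputs(T') is nonempty), then T = T'. -/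
/-- Byzcuit consistency (abstract core): under the Honest Shard assumption and
single pre-accept per object per honest node, no two conflicting transactions
(sharing an input object) are both committed. -/
theorem byzcuit_consistency {Node Object Tx : Type*}
    [DecidableEq Node] [DecidableEq Object] [DecidableEq Tx]
    (f : ℕ) (shard : Object → Finset Node) (Byz : Finset Node)
    (inputs : Tx → Finset Object)
    (preAccept : Node → Object → Tx → Prop)
    (hshard : ∀ o : Object, (shard o).card = 3 * f + 1)
    (hByz : ∀ o : Object, (shard o ∩ Byz).card ≤ f)
    (honest_once : ∀ n : Node, n ∉ Byz → ∀ (o : Object) (T T' : Tx),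
      preAccept n o T → preAccept n o T' → T = T')
    (T T' : Tx)
    (hT : ∀ o ∈ inputs T, ∃ Q : Finset Node,
      Q ⊆ shard o ∧ 2 * f + 1 ≤ Q.card ∧ ∀ n ∈ Q, preAccept n o T)
    (hT' : ∀ o ∈ inputs T', ∃ Q : Finset Node,
      Q ⊆ shard o ∧ 2 * f + 1 ≤ Q.card ∧ ∀ n ∈ Q, preAccept n o T')
    (hconflict : (inputs T ∩ inputs T').Nonempty) :
    T = T' := by
  obtain ⟨o, ho⟩ := hconflict
  rw [Finset.mem_inter] at ho
  obtain ⟨Q, hQ, hQc, hQp⟩ := hT o ho.1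
  obtain ⟨R, hR, hRc, hRp⟩ := hT' o ho.2
  by_contra hne
  have hsub : Q ∩ R ⊆ shard o ∩ Byz := by
    intro n hn
    rw [Finset.mem_inter] at hn ⊢
    refine ⟨hQ hn.1, ?_⟩
    by_contra hb
    exact hne (honest_once n hb o T T' (hQp n hn.1) (hRp n hn.2))
  have h1 := Finset.card_le_card hsub
  have h2 := Finset.card_le_card (Finset.union_subset hQ hR)
  have h3 := Finset.card_union_add_card_inter Q R
  have h4 := hshard o
  have h5 := hByz o
  omega
end

section
/- Coconut AggCred correctness (single attribute): Let 1 ≤ t < p, let h ∈ G, m ∈ ZMod p, and let v, w be polynomials over ZMod p of degree < t. For i = 1,…,t let σᵢ = (v(i) + w(i)·m) • h be the i-th partial credential, where v(i), w(i) denote evaluation at (i : ZMod p). Then ∑_{i=1}^{t} lᵢ • σᵢ = (v(0) + w(0)·m) • h; that is, aggregating any t partial credentials issued with the key shares (v(i), w(i)) yields the credential under the master key (x, y) = (v(0), w(0)). -/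
/-- Lagrange coefficient at nodes `1, …, t` evaluated at `0`:
`lᵢ = (∏_{j≠i} (0 - j)) · (∏_{j≠i} (i - j))⁻¹` in `ZMod p`. -/
def lagrangeCoeff (p t i : ℕ) : ZMod p :=
  (∏ j ∈ (Finset.Icc 1 t).erase i, ((0 : ZMod p) - (j : ZMod p))) *
    (∏ j ∈ (Finset.Icc 1 t).erase i, ((i : ZMod p) - (j : ZMod p)))⁻¹

theorem lagrange_aux {p : ℕ} [Fact p.Prime] (t : ℕ) (htp : t < p)
    (v : Polynomial (ZMod p)) (hv : v.natDegree < t) :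
    ∑ i ∈ Finset.Icc 1 t, lagrangeCoeff p t i * v.eval (i : ZMod p) = v.eval 0 := by
  have hinj : Set.InjOn (fun i : ℕ => (i : ZMod p)) (Finset.Icc 1 t : Finset ℕ) := by
    intro a ha b hb hab
    simp only [Finset.coe_Icc, Set.mem_Icc] at ha hb
    have h1 := (ZMod.natCast_eq_natCast_iff' a b p).1 hab
    rwa [Nat.mod_eq_of_lt (by omega), Nat.mod_eq_of_lt (by omega)] at h1
  have hd : v.degree < (Finset.Icc 1 t).card := by
    refine lt_of_le_of_lt Polynomial.degree_le_natDegree ?_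
    simpa using hv
  have key := congrArg (Polynomial.eval 0) (Lagrange.eq_interpolate hinj hd)
  rw [key, Lagrange.interpolate_apply, Polynomial.eval_finsetSum]
  refine Finset.sum_congr rfl fun i _ => ?_
  rw [Polynomial.eval_mul, Polynomial.eval_C, mul_comm]
  congr 1
  rw [lagrangeCoeff, Lagrange.basis, Polynomial.eval_prod, ← Finset.prod_inv_distrib,
    ← Finset.prod_mul_distrib]
  refine Finset.prod_congr rfl fun j _ => ?_
  simp [Lagrange.basisDivisor, mul_comm]

/-- Coconut `AggCred` correctness (single attribute): aggregating any `t`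
partial credentials issued with key shares `(v(i), w(i))` yields the credential
under the master key `(v(0), w(0))`. -/
theorem coconut_aggCred_correct {p : ℕ} [Fact p.Prime]
    {G : Type*} [AddCommGroup G] [Module (ZMod p) G]
    (t : ℕ) (ht1 : 1 ≤ t) (htp : t < p)
    (h : G) (m : ZMod p) (v w : Polynomial (ZMod p))
    (hv : v.natDegree < t) (hw : w.natDegree < t) :
    ∑ i ∈ Finset.Icc 1 t, lagrangeCoeff p t i •
        ((v.eval (i : ZMod p) + w.eval (i : ZMod p) * m) • h)
      = (v.eval 0 + w.eval 0 * m) • h := by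
  rw [← lagrange_aux t htp v hv, ← lagrange_aux t htp w hw, Finset.sum_mul,
    ← Finset.sum_add_distrib, Finset.sum_smul]
  refine Finset.sum_congr rfl fun i _ => ?_
  rw [smul_smul]
  congr 1
  ring
end

section
/- Coconut AggCred correctness (multi-attribute): Let 1 ≤ t < p, let h ∈ G, let m₁,…,m_q ∈ ZMod p be attributes, and let v, w₁,…,w_q be polynomials over ZMod p of degree < t. For i = 1,…,t let σᵢ = (v(i) + ∑_{j=1}^{q} m_j·w_j(i)) • h be the i-th partial credential. Then ∑_{i=1}^{t} lᵢ • σᵢ = (v(0) + ∑_{j=1}^{q} m_j·w_j(0)) • h; that is, aggregating any t partial multi-attribute credentials yields the credential under the master key (x, y₁,…,y_q) = (v(0), w₁(0),…,w_q(0)). -/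
theorem lagrangeCoeff_sum_aux {p : ℕ} [Fact p.Prime] (t : ℕ) (htp : t < p)
    (f : Polynomial (ZMod p)) (hf : f.degree < (t : WithBot ℕ)) :
    ∑ i ∈ Finset.Icc 1 t, lagrangeCoeff p t i * f.eval (i : ZMod p) = f.eval 0 := by
  have hinj : Set.InjOn (fun i : ℕ => (i : ZMod p)) (Finset.Icc 1 t : Finset ℕ) := by
    intro a ha b hb hab
    simp only [Finset.coe_Icc, Set.mem_Icc] at ha hb
    have h1 := (ZMod.natCast_eq_natCast_iff' a b p).1 hab
    rwa [Nat.mod_eq_of_lt (by omega), Nat.mod_eq_of_lt (by omega)] at h1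
  have h := Lagrange.eq_interpolate (f := f) hinj (by simpa using hf)
  conv_rhs => rw [h]
  rw [Lagrange.interpolate_apply, Polynomial.eval_finset_sum]
  refine Finset.sum_congr rfl fun i _ => ?_
  rw [Polynomial.eval_mul, Polynomial.eval_C, mul_comm]
  congr 1
  rw [Lagrange.basis, Polynomial.eval_prod, lagrangeCoeff, ← Finset.prod_inv_distrib,
    ← Finset.prod_mul_distrib]
  refine Finset.prod_congr rfl fun j _ => ?_
  simp [Lagrange.basisDivisor, mul_comm]

/-- Coconut `AggCred` correctness (multi-attribute): aggregating any `t`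
partial multi-attribute credentials yields the credential under the master key
`(v(0), w₁(0), …, w_q(0))`. -/
theorem coconut_aggCred_multi_correct {p : ℕ} [Fact p.Prime]
    {G : Type*} [AddCommGroup G] [Module (ZMod p) G]
    (t : ℕ) (ht1 : 1 ≤ t) (htp : t < p)
    (h : G) (q : ℕ) (m : Fin q → ZMod p)
    (v : Polynomial (ZMod p)) (w : Fin q → Polynomial (ZMod p))
    (hv : v.natDegree < t) (hw : ∀ j, (w j).natDegree < t) :
    ∑ i ∈ Finset.Icc 1 t, lagrangeCoeff p t i •
        ((v.eval (i : ZMod p) + ∑ j, m j * (w j).eval (i : ZMod p)) • h)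
      = (v.eval 0 + ∑ j, m j * (w j).eval 0) • h := by
  have hdeg : ∀ f : Polynomial (ZMod p), f.natDegree < t → f.degree < (t : WithBot ℕ) :=
    fun f hf => lt_of_le_of_lt Polynomial.degree_le_natDegree (by exact_mod_cast hf)
  have key := lagrangeCoeff_sum_aux t htp (v + ∑ j, Polynomial.C (m j) * w j) (by
    rw [← Polynomial.mem_degreeLT]
    refine Submodule.add_mem _ (Polynomial.mem_degreeLT.2 (hdeg v hv))
      (Submodule.sum_mem _ fun j _ => ?_)
    rw [← Polynomial.smul_eq_C_mul]
    exact Submodule.smul_mem _ _ (Polynomial.mem_degreeLT.2 (hdeg _ (hw j))))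
  simp only [Polynomial.eval_add, Polynomial.eval_finset_sum, Polynomial.eval_mul,
    Polynomial.eval_C] at key
  simp only [smul_smul]
  rw [← Finset.sum_smul, key]
end

section
/- Coconut Unblind correctness (multi-attribute): Let g, h ∈ G, d ∈ ZMod p with γ = d • g, and let x, y₁,…,y_q, m₁,…,m_q, k₁,…,k_q ∈ ZMod p. For each j let c_j = (a_j, b_j) = (k_j • g, k_j • γ + m_j • h) be the ElGamal encryption of m_j • h under γ. Let the authority's blinded partial credential be c̃ = (ã, b̃) = (∑_{j=1}^{q} y_j • a_j, x • h + ∑_{j=1}^{q} y_j • b_j). Then unblinding with d recovers the partial credential: b̃ − d • ã = (x + ∑_{j=1}^{q} y_j·m_j) • h. -/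
/-- Coconut `Unblind` correctness (multi-attribute): decrypting the blinded
multi-attribute partial credential with the ElGamal private key `d` recovers
the partial credential `(x + ∑ⱼ yⱼ·mⱼ) • h`. -/
theorem coconut_unblind_multi_correct {p : ℕ} [Fact p.Prime]
    {G : Type*} [AddCommGroup G] [Module (ZMod p) G]
    (g h : G) (d : ZMod p) (γ : G) (hγ : γ = d • g)
    (q : ℕ) (x : ZMod p) (y m k : Fin q → ZMod p)
    (a b : Fin q → G)
    (ha : ∀ j, a j = k j • g)
    (hb : ∀ j, b j = k j • γ + m j • h)
    (ta tb : G)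
    (hta : ta = ∑ j, y j • a j)
    (htb : tb = x • h + ∑ j, y j • b j) :
    tb - d • ta = (x + ∑ j, y j * m j) • h := by
  subst hγ hta htb
  rw [add_smul, Finset.sum_smul, Finset.smul_sum, add_sub_assoc, ← Finset.sum_sub_distrib]
  congr 1
  refine Finset.sum_congr rfl fun j _ => ?_
  rw [ha, hb]
  module
end

section
/- Coconut credential showing completeness (multi-attribute): Let g₂ ∈ G₂, h ∈ G₁, and x, y₁,…,y_q, m₁,…,m_q, r, r' ∈ ZMod p, with verification key components α = x • g₂ and β_j = y_j • g₂ for j = 1,…,q. Let σ = (h, s) be a credential on the attributes m₁,…,m_q, i.e., s = (x + ∑_{j=1}^{q} m_j·y_j) • h, and let the randomized credential be σ' = (h', s') = (r' • h, r' • s). Set κ = α + ∑_{j=1}^{q} m_j • β_j + r • g₂ and ν = r • h'. Then the pairing verification equation holds: e h' κ = e (s' + ν) g₂. -/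
/-- Coconut credential showing completeness (multi-attribute): an honestly
issued, randomized multi-attribute credential passes the pairing verification
equation `e(h', κ) = e(s' + ν, g₂)`. -/
theorem coconut_show_multi_complete {p : ℕ} [Fact p.Prime]
    {G₁ G₂ GT : Type*}
    [AddCommGroup G₁] [Module (ZMod p) G₁]
    [AddCommGroup G₂] [Module (ZMod p) G₂]
    [AddCommGroup GT] [Module (ZMod p) GT]
    (e : G₁ →ₗ[ZMod p] G₂ →ₗ[ZMod p] GT)
    (g₂ : G₂) (h : G₁) (q : ℕ)
    (x : ZMod p) (y m : Fin q → ZMod p) (r r' : ZMod p)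
    (α : G₂) (hα : α = x • g₂)
    (β : Fin q → G₂) (hβ : ∀ j, β j = y j • g₂)
    (s : G₁) (hs : s = (x + ∑ j, m j * y j) • h)
    (h' s' : G₁) (hh' : h' = r' • h) (hs' : s' = r' • s)
    (κ : G₂) (hκ : κ = α + (∑ j, m j • β j) + r • g₂)
    (ν : G₁) (hν : ν = r • h') :
    e h' κ = e (s' + ν) g₂ := by
  have hk : κ = (x + (∑ j, m j * y j) + r) • g₂ := by
    rw [hκ, hα]
    simp only [hβ, smul_smul, add_smul, Finset.sum_smul]
  have hsv : s' + ν = (x + (∑ j, m j * y j) + r) • h' := by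
    rw [hs', hν, hs, hh', smul_smul, smul_smul, smul_smul, ← add_smul]
    congr 1
    ring
  rw [hk, hsv, map_smul, map_smul, LinearMap.smul_apply]
end

section
/- Soundness of the Coconut pairing check in the span of the generator: Let g₁ ∈ G₁ and g₂ ∈ G₂ with e g₁ g₂ ≠ 0. Let x, y, m, r, c, d ∈ ZMod p with c ≠ 0, and set h' = c • g₁, s' = d • g₁, κ = x • g₂ + m • (y • g₂) + r • g₂ and ν = r • h'. If the verification equation e h' κ = e (s' + ν) g₂ holds, then s' = (x + y·m) • h'; that is, a pair (h', s') in the span of g₁ with h' ≠ 0 passing the check is necessarily a valid credential on m. -/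
/-- Soundness of the Coconut pairing check in the span of the generator: a pair
`(h', s')` in the span of `g₁` with `h' ≠ 0` that passes the verification
equation is necessarily a valid credential on `m`. -/
theorem coconut_check_sound {p : ℕ} [Fact p.Prime]
    {G₁ G₂ GT : Type*}
    [AddCommGroup G₁] [Module (ZMod p) G₁]
    [AddCommGroup G₂] [Module (ZMod p) G₂]
    [AddCommGroup GT] [Module (ZMod p) GT]
    (e : G₁ →ₗ[ZMod p] G₂ →ₗ[ZMod p] GT)
    (g₁ : G₁) (g₂ : G₂) (hne : e g₁ g₂ ≠ 0)
    (x y m r c d : ZMod p) (hc : c ≠ 0)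
    (h' s' : G₁) (hh' : h' = c • g₁) (hs' : s' = d • g₁)
    (κ : G₂) (hκ : κ = x • g₂ + m • (y • g₂) + r • g₂)
    (ν : G₁) (hν : ν = r • h')
    (hver : e h' κ = e (s' + ν) g₂) :
    s' = (x + y * m) • h' := by
  subst hν hκ hh' hs'
  simp only [map_add, map_smul, LinearMap.add_apply, LinearMap.smul_apply] at hver
  have h1 : (c * (x + m * y + r)) • e g₁ g₂ = (d + r * c) • e g₁ g₂ := by
    linear_combination (norm := module) hver
  have h2 := smul_left_injective (ZMod p) hne h1
  rw [smul_smul]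
  congr 1
  linear_combination -h2
end

section
/- End-to-end correctness of Coconut threshold credentials: Let 1 ≤ t < p, let g₂ ∈ G₂, h ∈ G₁, m, r, r' ∈ ZMod p, and let v, w be polynomials over ZMod p of degree < t. Let the partial credentials be σᵢ = (v(i) + w(i)·m) • h for i = 1,…,t, the aggregated credential s = ∑_{i=1}^{t} lᵢ • σᵢ, and the randomized credential (h', s') = (r' • h, r' • s). With x = v(0), y = w(0), α = x • g₂, β = y • g₂, κ = α + m • β + r • g₂ and ν = r • h', the pairing verification equation holds: e h' κ = e (s' + ν) g₂. That is, a credential obtained by aggregating any t honestly issued partial credentials, then randomized and shown, passes verification under the aggregated verification key. -/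
theorem lagrange_zero {p : ℕ} [Fact p.Prime] (t : ℕ) (htp : t < p)
    (f : Polynomial (ZMod p)) (hf : f.natDegree < t) :
    ∑ i ∈ Finset.Icc 1 t, lagrangeCoeff p t i * f.eval (i : ZMod p) = f.eval 0 := by
  have hinj : Set.InjOn (fun i : ℕ => (i : ZMod p)) (Finset.Icc 1 t : Finset ℕ) := by
    intro a ha b hb hab
    simp only [Finset.coe_Icc, Set.mem_Icc] at ha hb
    have h2 := (ZMod.natCast_eq_natCast_iff a b p).1 hab
    exact Nat.ModEq.eq_of_lt_of_lt h2 (by omega) (by omega)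
  have hdeg : f.degree < ((Finset.Icc 1 t).card : ℕ) := by
    rw [Nat.card_Icc]
    exact lt_of_le_of_lt Polynomial.degree_le_natDegree (by exact_mod_cast (by omega))
  have h := congrArg (Polynomial.eval 0) (Lagrange.eq_interpolate hinj hdeg)
  rw [h, Lagrange.interpolate_apply, Polynomial.eval_finset_sum]
  refine Finset.sum_congr rfl fun i _ => ?_
  rw [Polynomial.eval_mul, Polynomial.eval_C, mul_comm]
  congr 1
  unfold lagrangeCoeff Lagrange.basis Lagrange.basisDivisor
  rw [Polynomial.eval_prod, ← Finset.prod_inv_distrib, ← Finset.prod_mul_distrib]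
  refine Finset.prod_congr rfl fun j _ => ?_
  simp [mul_comm]

/-- End-to-end correctness of Coconut threshold credentials: a credential
obtained by aggregating any `t` honestly issued partial credentials, then
randomized and shown, passes the pairing verification equation under the
aggregated verification key. -/
theorem coconut_end_to_end {p : ℕ} [Fact p.Prime]
    {G₁ G₂ GT : Type*}
    [AddCommGroup G₁] [Module (ZMod p) G₁]
    [AddCommGroup G₂] [Module (ZMod p) G₂]
    [AddCommGroup GT] [Module (ZMod p) GT]
    (e : G₁ →ₗ[ZMod p] G₂ →ₗ[ZMod p] GT)
    (t : ℕ) (ht1 : 1 ≤ t) (htp : t < p)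
    (g₂ : G₂) (h : G₁) (m r r' : ZMod p)
    (v w : Polynomial (ZMod p)) (hv : v.natDegree < t) (hw : w.natDegree < t)
    (σ : ℕ → G₁)
    (hσ : ∀ i, σ i = (v.eval (i : ZMod p) + w.eval (i : ZMod p) * m) • h)
    (s : G₁) (hs : s = ∑ i ∈ Finset.Icc 1 t, lagrangeCoeff p t i • σ i)
    (h' s' : G₁) (hh' : h' = r' • h) (hs' : s' = r' • s)
    (x y : ZMod p) (hx : x = v.eval 0) (hy : y = w.eval 0)
    (α β : G₂) (hα : α = x • g₂) (hβ : β = y • g₂)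
    (κ : G₂) (hκ : κ = α + m • β + r • g₂)
    (ν : G₁) (hν : ν = r • h') :
    e h' κ = e (s' + ν) g₂ := by
  have key : s = (x + y * m) • h := by
    rw [hs, hx, hy, ← lagrange_zero t htp v hv, ← lagrange_zero t htp w hw, Finset.sum_mul,
      ← Finset.sum_add_distrib, Finset.sum_smul]
    refine Finset.sum_congr rfl fun i _ => ?_
    rw [hσ, smul_smul]
    congr 1
    ring
  subst hν hκ hα hβ hs' hh'
  rw [key]
  simp only [map_add, map_smul, LinearMap.add_apply, LinearMap.smul_apply, smul_smul,
    ← add_smul, smul_add]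
  congr 1
  ring
end
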